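/- Let d=d_1+d_2 with d_1≥2 and d_2≥1. Suppose V=V_1⊕V_2 and Y=Y_1⊕Y_2 are real Γ-periodic potentials on ℤ^d that are (d_1,d_2)-separable, where V_1,Y_1 are functions on ℤ^{d_1} periodic with respect to q_1ℤ⊕⋯⊕q_{d_1}ℤ and V_2,Y_2 are functions on ℤ^{d_2} periodic with respect to q_{d_1+1}ℤ⊕⋯⊕q_dℤ. If V and Y are Fermi isospectral, then there exists a constant c∈ℝ such that V_2+c and Y_2 are Floquet isospectral (as periodic potentials on ℤ^{d_2} with periods q_{d_1+1},…,q_d). -/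

import Mathlib

noncomputable section

/-- The discrete Laplacian on `ℤ^d`: `(Δu)(n) = Σ_{‖n'-n‖₁ = 1} u(n')`. -/
def discLap {d : ℕ} (u : (Fin d → ℤ) → ℂ) (n : Fin d → ℤ) : ℂ :=
  ∑ j : Fin d, (u (Function.update n j (n j + 1)) + u (Function.update n j (n j - 1)))

/-- Reduction of an integer modulo `q`, as an element of `Fin q`. -/
def fem (q : ℕ+) (a : ℤ) : Fin (q : ℕ) :=
  ⟨(a % ((q : ℕ) : ℤ)).toNat, by
    have hq : (0:ℤ) < ((q : ℕ) : ℤ) := by exact_mod_cast q.pos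
    have h1 : 0 ≤ a % ((q : ℕ) : ℤ) := Int.emod_nonneg a (ne_of_gt hq)
    have h2 : a % ((q : ℕ) : ℤ) < ((q : ℕ) : ℤ) := Int.emod_lt_of_pos a hq
    omega⟩

/-- Extension of a function on the fundamental domain `W` to `ℤ^d` using the
Floquet boundary conditions `u(n + qⱼ eⱼ) = zⱼ u(n)`. -/
def extendBC {d : ℕ} (q : Fin d → ℕ+) (z : Fin d → ℂ)
    (u : (∀ j, Fin ((q j : ℕ))) → ℂ) : (Fin d → ℤ) → ℂ :=
  fun n => (∏ j, z j ^ (n j / ((q j : ℕ) : ℤ))) * u (fun j => fem (q j) (n j))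

/-- The matrix `D_V(z)` of the Floquet reduction of `-Δ + V` to the fundamental domain. -/
def DVmat {d : ℕ} (q : Fin d → ℕ+) (V : (Fin d → ℤ) → ℂ) (z : Fin d → ℂ) :
    Matrix (∀ j, Fin ((q j : ℕ))) (∀ j, Fin ((q j : ℕ))) ℂ :=
  fun n n' =>
    -(discLap (extendBC q z (Pi.single n' 1)) (fun j => ((n j : ℕ) : ℤ)))
      + V (fun j => ((n j : ℕ) : ℤ)) * (if n = n' then 1 else 0)

/-- `𝒫_V(z, λ) = det(D_V(z) - λ I)`. -/
def scriptP {d : ℕ} (q : Fin d → ℕ+) (V : (Fin d → ℤ) → ℂ) (z : Fin d → ℂ)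
    (lam : ℂ) : ℂ :=
  Matrix.det (DVmat q V z - lam • (1 : Matrix (∀ j, Fin ((q j : ℕ))) (∀ j, Fin ((q j : ℕ))) ℂ))

/-- `Γ`-periodicity for a complex-valued function on `ℤ^d`. -/
def IsPeriodic {d : ℕ} (q : Fin d → ℕ+) (V : (Fin d → ℤ) → ℂ) : Prop :=
  ∀ (n : Fin d → ℤ) (j : Fin d), V (Function.update n j (n j + ((q j : ℕ) : ℤ))) = V n

/-- `Γ`-periodicity for a real-valued function on `ℤ^d`. -/
def IsPeriodicR {d : ℕ} (q : Fin d → ℕ+) (V : (Fin d → ℤ) → ℝ) : Prop :=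
  ∀ (n : Fin d → ℤ) (j : Fin d), V (Function.update n j (n j + ((q j : ℕ) : ℤ))) = V n

/-- `ρ_m = e^{2πi m / q}`. -/
def rho (q : ℕ+) (m : ℕ) : ℂ :=
  Complex.exp (2 * (Real.pi : ℂ) * Complex.I * (m : ℂ) / ((q : ℕ) : ℂ))

/-- The discrete Fourier transform `V̂(l)` of a periodic potential. -/
def dft {d : ℕ} (q : Fin d → ℕ+) (V : (Fin d → ℤ) → ℂ) (l : Fin d → ℤ) : ℂ :=
  (1 / ((∏ j, (q j : ℕ) : ℕ) : ℂ)) * ∑ n : (∀ j, Fin ((q j : ℕ))),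
    V (fun j => ((n j : ℕ) : ℤ)) *
      Complex.exp (-(2 * (Real.pi : ℂ) * Complex.I) * ∑ j, (l j : ℂ) * ((n j : ℕ) : ℂ) / ((q j : ℕ) : ℂ))

/-- The diagonal matrix `A(z)` with entries `-Σⱼ (ρʲ_{nⱼ} zⱼ + 1/(ρʲ_{nⱼ} zⱼ))`. -/
def Amat {d : ℕ} (q : Fin d → ℕ+) (z : Fin d → ℂ) :
    Matrix (∀ j, Fin ((q j : ℕ))) (∀ j, Fin ((q j : ℕ))) ℂ :=
  Matrix.diagonal fun n => -(∑ j, (rho (q j) (n j) * z j + (rho (q j) (n j) * z j)⁻¹))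

/-- The matrix `B_V` with entries `V̂(n - n')`. -/
def Bmat {d : ℕ} (q : Fin d → ℕ+) (V : (Fin d → ℤ) → ℂ) :
    Matrix (∀ j, Fin ((q j : ℕ))) (∀ j, Fin ((q j : ℕ))) ℂ :=
  fun n n' => dft q V (fun j => ((n j : ℕ) : ℤ) - ((n' j : ℕ) : ℤ))

/-- The average `[V]` of a periodic potential. -/
def avgPot {d : ℕ} (q : Fin d → ℕ+) (V : (Fin d → ℤ) → ℂ) : ℂ :=
  (1 / ((∏ j, (q j : ℕ) : ℕ) : ℂ)) * ∑ n : (∀ j, Fin ((q j : ℕ))), V (fun j => ((n j : ℕ) : ℤ))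

/-- The Fermi variety `F_λ(V)`. -/
def FermiVariety {d : ℕ} (q : Fin d → ℕ+) (V : (Fin d → ℤ) → ℂ) (lam : ℂ) :
    Set (Fin d → ℂ) :=
  {k | ∃ u : (Fin d → ℤ) → ℂ, u ≠ 0 ∧
    (∀ n, -(discLap u n) + V n * u n = lam * u n) ∧
    (∀ (n : Fin d → ℤ) (j : Fin d),
      u (Function.update n j (n j + ((q j : ℕ) : ℤ)))
        = Complex.exp (2 * (Real.pi : ℂ) * Complex.I * k j) * u n)}

/-- Floquet isospectrality of two real periodic potentials. -/
def FloquetIso {d : ℕ} (q : Fin d → ℕ+) (V Y : (Fin d → ℤ) → ℝ) : Prop :=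
  ∀ k : Fin d → ℝ,
    spectrum ℂ (DVmat q (fun n => ((V n : ℝ) : ℂ))
        (fun j => Complex.exp (2 * (Real.pi : ℂ) * Complex.I * (k j : ℂ))))
      = spectrum ℂ (DVmat q (fun n => ((Y n : ℝ) : ℂ))
        (fun j => Complex.exp (2 * (Real.pi : ℂ) * Complex.I * (k j : ℂ))))

/-- A function on `(ℂ^*)^d` given by a Laurent polynomial. -/
def IsLaurent {d : ℕ} (f : (Fin d → ℂ) → ℂ) : Prop :=
  ∃ c : (Fin d → ℤ) →₀ ℂ, ∀ z : Fin d → ℂ, (∀ j, z j ≠ 0) →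
    f z = c.sum fun a C => C * ∏ j, z j ^ a j

/-- A Laurent monomial `C z₁^{a₁} ⋯ z_d^{a_d}` with `C ≠ 0`. -/
def IsMonomial {d : ℕ} (f : (Fin d → ℂ) → ℂ) : Prop :=
  ∃ (C : ℂ) (a : Fin d → ℤ), C ≠ 0 ∧ ∀ z : Fin d → ℂ, (∀ j, z j ≠ 0) →
    f z = C * ∏ j, z j ^ a j

/-- Irreducibility of a Laurent polynomial: no factorization into two non-monomial
Laurent polynomials. -/
def LaurentIrreducible {d : ℕ} (h : (Fin d → ℂ) → ℂ) : Prop :=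
  ¬ ∃ f g : (Fin d → ℂ) → ℂ, IsLaurent f ∧ IsLaurent g ∧
      ¬ IsMonomial f ∧ ¬ IsMonomial g ∧
      ∀ z : Fin d → ℂ, (∀ j, z j ≠ 0) → h z = f z * g z

section SimpleZero

open Filter Topology

/-- Let `L` have a simple eigenvalue `0`, with eigenvector `e` and left eigenvector `ℓ`. If the
first-order condition `ℓ (R (0, s₀) e) = 0` holds, then `L p = τ • R (τ, s) p` has nonzero solutions
`p` for `(τ, s)` arbitrarily close to `(0, s₀)` with `τ ≠ 0`. -/
theorem frequently_exists_ker_of_simple {E : Type*} [NormedAddCommGroup E] [NormedSpace ℂ E]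
    [FiniteDimensional ℂ E] (L : E →L[ℂ] E) (ℓ : E →L[ℂ] ℂ) (e : E) (hℓe : ℓ e = 1)
    (hLe : L e = 0) (hℓL : ∀ x, ℓ (L x) = 0) (hker : ∀ x, L x = 0 → ℓ x = 0 → x = 0)
    (R : ℂ × ℂ → E →L[ℂ] E) (s₀ : ℂ) (hR : ContDiffAt ℂ 1 R (0, s₀)) (R₀ S : E →L[ℂ] E)
    (hR₀ : ∀ s, R (0, s) = R₀ - s • S) (hS : ℓ (S e) = 1) (hs₀ : ℓ (R₀ e) = s₀) :
    ∃ᶠ x in 𝓝 ((0 : ℂ), s₀), x.1 ≠ 0 ∧ ∃ p, p ≠ 0 ∧ L p = x.1 • R x p := by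
  set P : E → E := fun x => e + x - ℓ x • e with hP
  have hℓP : ∀ x, ℓ (P x) = 1 := fun x => by simp [hP, hℓe]
  set F : ℂ × E → ℂ × E := fun w => (w.1, w.1 • R (w.1, s₀ + ℓ w.2) (P w.2)
    + ((1 - w.1) * ℓ (R (w.1, s₀ + ℓ w.2) (P w.2))) • e - L (P w.2)) with hF
  have hF0 : F 0 = 0 := by
    simp [hF, hP, hR₀, hLe, hS, hs₀]
  have hFc : ContDiffAt ℂ 1 F 0 := by
    have h1 : ContDiffAt ℂ 1 (fun w : ℂ × E => R (w.1, s₀ + ℓ w.2)) 0 := by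
      have : ContDiffAt ℂ 1 R ((fun w : ℂ × E => (w.1, s₀ + ℓ w.2)) 0) := by simpa using hR
      exact this.comp 0 (by fun_prop)
    have h2 : ContDiffAt ℂ 1 (fun w : ℂ × E => P w.2) 0 := by
      simp only [hP]; fun_prop
    have h3 := h1.clm_apply h2
    refine ContDiffAt.prodMk contDiffAt_fst ?_
    refine ContDiffAt.sub (ContDiffAt.add (contDiffAt_fst.smul h3) ?_) (L.contDiff.contDiffAt.comp 0 h2)
    exact ((contDiffAt_const.sub contDiffAt_fst).mul (ℓ.contDiff.contDiffAt.comp 0 h3)).smul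
      contDiffAt_const
  have hstrict := hFc.hasStrictFDerivAt one_ne_zero
  set F' := fderiv ℂ F 0 with hF'
  have hinj : Function.Injective F' := by
    rw [injective_iff_map_eq_zero]
    rintro ⟨t, y⟩ h
    have hfst : t = 0 := by
      have h1 : HasFDerivAt (fun w => (F w).1) ((ContinuousLinearMap.fst ℂ ℂ E).comp F') 0 :=
        HasFDerivAt.comp (g := fun w : ℂ × E => w.1) 0 hasFDerivAt_fst hstrict.hasFDerivAt
      have h2 : HasFDerivAt (fun w => (F w).1) (ContinuousLinearMap.fst ℂ ℂ E) 0 := hasFDerivAt_fst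
      have := congrArg (fun f => f (t, y)) (h1.unique h2)
      simpa [h] using this.symm
    subst hfst
    have hline : HasDerivAt (fun a : ℂ => ((0 : ℂ), a • y)) ((0 : ℂ), y) 0 := by
      have := (hasDerivAt_const (0 : ℂ) (0 : ℂ)).prodMk ((hasDerivAt_id (0 : ℂ)).smul_const y)
      simpa using this
    have hcomp : HasDerivAt (fun a : ℂ => F (0, a • y)) 0 0 := by
      have h1 : HasFDerivAt F F' ((fun a : ℂ => ((0 : ℂ), a • y)) 0) := by
        simp only [zero_smul]
        exact hstrict.hasFDerivAt
      have := h1.comp_hasDerivAt (0 : ℂ) hline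
      rwa [h] at this
    have hexp : ∀ a : ℂ, (F (0, a • y)).2 =
        (ℓ (R₀ (e + a • (y - ℓ y • e))) - (s₀ + a * ℓ y) * ℓ (S (e + a • (y - ℓ y • e)))) • e
          - a • L y := by
      intro a
      have : P (a • y) = e + a • (y - ℓ y • e) := by
        simp only [hP, map_smul, smul_eq_mul]; module
      simp only [hF, this, hR₀, map_add, hLe, map_smul, map_sub, sub_apply,
        smul_apply, smul_eq_mul]
      simp only [zero_smul, zero_add, sub_zero, one_mul]
      congr 2
      · ring
      · rw [smul_zero, sub_zero]
    have hL : ∀ a : ℂ, L ((F (0, a • y)).2) = - a • L (L y) := by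
      intro a
      rw [hexp]; simp [hLe]
    have hℓF : ∀ a : ℂ, ℓ ((F (0, a • y)).2) =
        (ℓ (R₀ (e + a • (y - ℓ y • e))) - (s₀ + a * ℓ y) * ℓ (S (e + a • (y - ℓ y • e)))) := by
      intro a
      rw [hexp]; simp [hℓe, hℓL]
    have hsnd : HasDerivAt (fun a : ℂ => (F (0, a • y)).2) 0 0 := by
      exact (ContinuousLinearMap.snd ℂ ℂ E).hasFDerivAt.comp_hasDerivAt (0 : ℂ) hcomp
    have hLy : L (L y) = 0 := by
      have h1 := L.hasFDerivAt.comp_hasDerivAt (0 : ℂ) hsnd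
      have h2 : HasDerivAt (fun a : ℂ => - a • L (L y)) (-(1 : ℂ) • L (L y)) 0 :=
        (hasDerivAt_id (0 : ℂ)).neg.smul_const _
      have h3 : (L ∘ fun a : ℂ => (F (0, a • y)).2) = fun a : ℂ => - a • L (L y) := funext hL
      rw [h3] at h1
      simpa using h1.unique h2
    have hLy1 : L y = 0 := hker _ hLy (hℓL y)
    have hy1 : y - ℓ y • e = 0 := hker _ (by simp [hLy1, hLe]) (by simp [hℓe])
    have hy2 : ℓ y = 0 := by
      have h1 := ℓ.hasFDerivAt.comp_hasDerivAt (0 : ℂ) hsnd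
      have h3 : (ℓ ∘ fun a : ℂ => (F (0, a • y)).2) = fun a : ℂ => - a * ℓ y := by
        funext a
        simp only [Function.comp, hℓF, hy1, smul_zero, add_zero, hs₀, hS]; ring
      have h2 : HasDerivAt (fun a : ℂ => - a * ℓ y) (-(1 : ℂ) * ℓ y) 0 :=
        (hasDerivAt_id (0 : ℂ)).neg.mul_const _
      rw [h3] at h1
      simpa using h1.unique h2
    have : y = 0 := by simpa [hy2] using hy1
    simp [this]
  have hsurj : (F' : ℂ × E →ₗ[ℂ] ℂ × E).range = ⊤ :=
    LinearMap.range_eq_top.2 (LinearMap.injective_iff_surjective.1 hinj)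
  have hmap := hstrict.map_nhds_eq_of_surj hsurj
  rw [hF0] at hmap
  have hfreq : ∃ᶠ y in 𝓝 (0 : ℂ × E), y.1 ≠ 0 ∧ y.2 = 0 := by
    have ht : Tendsto (fun τ : ℂ => (τ, (0 : E))) (𝓝 0) (𝓝 0) :=
      Continuous.tendsto' (by fun_prop) _ _ rfl
    refine ht.frequently (p := fun y : ℂ × E => y.1 ≠ 0 ∧ y.2 = 0) ?_
    have : ∃ᶠ τ in 𝓝 (0 : ℂ), τ ≠ 0 := by
      rw [frequently_iff_neBot]
      exact NormedField.nhdsNE_neBot 0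
    simpa using this
  rw [← hmap, frequently_map] at hfreq
  have htend : Tendsto (fun w : ℂ × E => (w.1, s₀ + ℓ w.2)) (𝓝 0) (𝓝 (0, s₀)) :=
    Continuous.tendsto' (by fun_prop) _ _ (by simp)
  refine htend.frequently (hfreq.mono ?_)
  rintro ⟨τ, x⟩ ⟨h1, h2⟩
  refine ⟨h1, P x, fun h0 => by simpa [h0] using hℓP x, ?_⟩
  simp only [hF] at h1 h2 ⊢
  have h3 := congrArg ℓ h2
  simp only [map_add, map_sub, map_smul, hℓL, hℓe, smul_eq_mul, map_zero] at h3
  have h4 : ℓ (R (τ, s₀ + ℓ x) (P x)) = 0 := by linear_combination h3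
  rw [h4] at h2
  simp only [mul_zero, zero_smul, add_zero] at h2
  exact (sub_eq_zero.1 h2).symm

/-- The first-order condition in `frequently_exists_ker_of_simple` is necessary. -/
theorem eq_of_frequently_exists_ker {E : Type*} [NormedAddCommGroup E] [NormedSpace ℂ E]
    [FiniteDimensional ℂ E] (L : E →L[ℂ] E) (ℓ : E →L[ℂ] ℂ) (e : E) (hℓe : ℓ e = 1)
    (hLe : L e = 0) (hℓL : ∀ x, ℓ (L x) = 0) (hker : ∀ x, L x = 0 → ℓ x = 0 → x = 0)
    (R : ℂ × ℂ → E →L[ℂ] E) (s₀ : ℂ) (hR : ContinuousAt R (0, s₀)) (R₀ S : E →L[ℂ] E)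
    (hR₀ : ∀ s, R (0, s) = R₀ - s • S) (hS : ℓ (S e) = 1)
    (h : ∃ᶠ x in 𝓝 ((0 : ℂ), s₀), x.1 ≠ 0 ∧ ∃ p, p ≠ 0 ∧ L p = x.1 • R x p) :
    ℓ (R₀ e) = s₀ := by
  have : CompleteSpace E := FiniteDimensional.complete ℂ E
  set K : ℂ × ℂ → E →L[ℂ] E := fun x =>
    x.1 • R x + (1 - x.1) • ((ℓ.comp (R x)).smulRight e) - L with hK
  have hKapp : ∀ x p, K x p = x.1 • R x p + (1 - x.1) • (ℓ (R x p)) • e - L p := fun x p => rfl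
  have hKc : ContinuousAt K (0, s₀) := by
    have h1 : ContinuousAt (fun x => (ℓ.comp (R x)).smulRight e) ((0 : ℂ), s₀) := by
      have h2 : ContinuousAt (fun x => (ℓ.smulRight e).comp (R x)) ((0 : ℂ), s₀) :=
        continuousAt_const.clm_comp hR
      exact h2
    exact ((continuousAt_fst.smul hR).add ((continuousAt_const.sub continuousAt_fst).smul h1)).sub
      continuousAt_const
  have hnu : ¬ IsUnit (K (0, s₀)) := by
    intro hu
    have hev : ∀ᶠ x in 𝓝 ((0 : ℂ), s₀), IsUnit (K x) := hKc.eventually (Units.isOpen.mem_nhds hu)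
    obtain ⟨x, ⟨hx, p, hp, hLp⟩, hux⟩ := (h.and_eventually hev).exists
    apply hp
    have h0 : K x p = 0 := by
      have h1 := congrArg ℓ hLp
      simp only [hℓL, map_smul, smul_eq_mul] at h1
      have h2 : ℓ (R x p) = 0 := by
        rcases mul_eq_zero.1 h1.symm with h | h
        · exact absurd h hx
        · exact h
      rw [hKapp, h2, hLp]; simp
    obtain ⟨v, hv⟩ := hux.exists_left_inv
    have := congrArg (fun f : E →L[ℂ] E => f p) hv
    simpa [h0] using this.symm
  by_contra hne
  apply hnu
  have hinj : Function.Injective (K (0, s₀)) := by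
    rw [injective_iff_map_eq_zero]
    intro p hp
    rw [hKapp] at hp
    simp only [zero_smul, sub_zero, one_smul, zero_add, hR₀] at hp
    have h1 := congrArg ℓ hp
    simp only [map_sub, map_smul, hℓL, hℓe, map_zero, smul_eq_mul, mul_one, sub_zero] at h1
    rw [h1, zero_smul, zero_sub, neg_eq_zero] at hp
    have h2 : p = ℓ p • e := sub_eq_zero.1 (hker _ (by simp [hp, hLe]) (by simp [hℓe]))
    rw [h2] at h1
    simp only [sub_apply, smul_apply, map_smul, map_sub,
      smul_eq_mul, hS] at h1
    have h3 : ℓ p * (ℓ (R₀ e) - s₀) = 0 := by linear_combination h1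
    rcases mul_eq_zero.1 h3 with h | h
    · rw [h2, h, zero_smul]
    · exact absurd (sub_eq_zero.1 h) hne
  have hbij : Function.Bijective (K (0, s₀)) :=
    ⟨hinj, (LinearMap.injective_iff_surjective (f := (K (0, s₀) : E →ₗ[ℂ] E))).1 hinj⟩
  exact ContinuousLinearMap.isUnit_iff_bijective.2 hbij

end SimpleZero

section Floquet

variable {d : ℕ}

theorem update_add_eq_add_single (n : Fin d → ℤ) (j : Fin d) (a : ℤ) :
    Function.update n j (n j + a) = n + Pi.single j a := by
  ext i
  by_cases h : i = j
  · subst h; simp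
  · simp [h]

theorem discLap_eq_sum (u : (Fin d → ℤ) → ℂ) (n : Fin d → ℤ) :
    discLap u n = ∑ j, (u (n + Pi.single j 1) + u (n + Pi.single j (-1))) := by
  simp only [discLap, sub_eq_add_neg, update_add_eq_add_single]

/-- The Floquet boundary condition `u(n + qⱼ eⱼ) = zⱼ u(n)`. -/
def QuasiPeriodic (q : Fin d → ℕ+) (z : Fin d → ℂ) (u : (Fin d → ℤ) → ℂ) : Prop :=
  ∀ n j, u (n + Pi.single j ((q j : ℕ) : ℤ)) = z j * u n

/-- `(-Δ + V) u = λ u` has a nonzero solution with Floquet multipliers `z`. -/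
def HasFloquetSolution (q : Fin d → ℕ+) (V : (Fin d → ℤ) → ℂ) (z : Fin d → ℂ) (lam : ℂ) : Prop :=
  ∃ u : (Fin d → ℤ) → ℂ, u ≠ 0 ∧ (∀ n, -(discLap u n) + V n * u n = lam * u n) ∧
    QuasiPeriodic q z u

theorem mem_FermiVariety_iff {q : Fin d → ℕ+} {V : (Fin d → ℤ) → ℂ} {lam : ℂ} {k : Fin d → ℂ} :
    k ∈ FermiVariety q V lam ↔ HasFloquetSolution q V
      (fun j => Complex.exp (2 * (Real.pi : ℂ) * Complex.I * k j)) lam := by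
  simp only [FermiVariety, HasFloquetSolution, QuasiPeriodic, update_add_eq_add_single,
    Set.mem_ofPred_eq]

theorem QuasiPeriodic.add_single_mul {q : Fin d → ℕ+} {z : Fin d → ℂ} (hz : ∀ j, z j ≠ 0)
    {u : (Fin d → ℤ) → ℂ} (hu : QuasiPeriodic q z u) (n : Fin d → ℤ) (j : Fin d) (k : ℤ) :
    u (n + Pi.single j (((q j : ℕ) : ℤ) * k)) = z j ^ k * u n := by
  induction k using Int.induction_on with
  | zero => simp
  | succ k ih =>
    rw [mul_add, Pi.single_add, ← add_assoc, mul_one, hu, ih, zpow_add_one₀ (hz j)]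
    ring
  | pred k ih =>
    have h := hu (n + Pi.single j (((q j : ℕ) : ℤ) * (-(k : ℤ) - 1))) j
    rw [add_assoc, ← Pi.single_add, show ((q j : ℕ) : ℤ) * (-(k : ℤ) - 1) + ((q j : ℕ) : ℤ)
      = ((q j : ℕ) : ℤ) * -(k : ℤ) by ring, ih] at h
    rw [zpow_sub_one₀ (hz j), mul_right_comm, h]
    field_simp [hz j]

theorem QuasiPeriodic.eq_prod_mul {q : Fin d → ℕ+} {z : Fin d → ℂ} (hz : ∀ j, z j ≠ 0)
    {u : (Fin d → ℤ) → ℂ} (hu : QuasiPeriodic q z u) (n : Fin d → ℤ) :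
    u n = (∏ j, z j ^ (n j / ((q j : ℕ) : ℤ))) * u (fun j => n j % ((q j : ℕ) : ℤ)) := by
  have key : ∀ s : Finset (Fin d), u n = (∏ j ∈ s, z j ^ (n j / ((q j : ℕ) : ℤ))) *
      u (fun j => if j ∈ s then n j % ((q j : ℕ) : ℤ) else n j) := by
    intro s
    induction s using Finset.induction_on with
    | empty => simp
    | insert a s ha ih =>
      have h := hu.add_single_mul hz
        (fun j => if j ∈ insert a s then n j % ((q j : ℕ) : ℤ) else n j) a (n a / ((q a : ℕ) : ℤ))
      have h2 : (fun j => if j ∈ insert a s then n j % ((q j : ℕ) : ℤ) else n j)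
          + Pi.single a (((q a : ℕ) : ℤ) * (n a / ((q a : ℕ) : ℤ)))
          = fun j => if j ∈ s then n j % ((q j : ℕ) : ℤ) else n j := by
        ext j
        by_cases hj : j = a
        · subst hj
          simp [ha, Int.emod_add_mul_ediv]
        · simp [hj]
      rw [h2] at h
      rw [Finset.prod_insert ha, ih, h]
      ring
  simpa using key Finset.univ

theorem fem_val (q : ℕ+) (a : ℤ) : (((fem q a : Fin (q : ℕ)) : ℕ) : ℤ) = a % ((q : ℕ) : ℤ) := by
  have hq : (0 : ℤ) < ((q : ℕ) : ℤ) := by exact_mod_cast q.pos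
  simp only [fem]
  exact Int.toNat_of_nonneg (Int.emod_nonneg a hq.ne')

theorem QuasiPeriodic.eq_extendBC {q : Fin d → ℕ+} {z : Fin d → ℂ} (hz : ∀ j, z j ≠ 0)
    {u : (Fin d → ℤ) → ℂ} (hu : QuasiPeriodic q z u) :
    u = extendBC q z (fun m => u (fun j => ((m j : ℕ) : ℤ))) := by
  funext n
  rw [hu.eq_prod_mul hz n]
  simp only [extendBC, fem_val]

theorem QuasiPeriodic.eq_zero {q : Fin d → ℕ+} {z : Fin d → ℂ} (hz : ∀ j, z j ≠ 0)
    {u : (Fin d → ℤ) → ℂ} (hu : QuasiPeriodic q z u)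
    (h : ∀ m : ∀ j, Fin (q j : ℕ), u (fun j => ((m j : ℕ) : ℤ)) = 0) : u = 0 := by
  rw [hu.eq_extendBC hz]
  funext n
  simp [extendBC, h]

theorem quasiPeriodic_extendBC {q : Fin d → ℕ+} {z : Fin d → ℂ} (hz : ∀ j, z j ≠ 0)
    (v : (∀ j, Fin (q j : ℕ)) → ℂ) : QuasiPeriodic q z (extendBC q z v) := by
  intro n j
  have hq : ∀ i, ((q i : ℕ) : ℤ) ≠ 0 := fun i => by exact_mod_cast (q i).pos.ne'
  have h1 : ∀ i, z i ^ ((n + Pi.single j ((q j : ℕ) : ℤ) : Fin d → ℤ) i / ((q i : ℕ) : ℤ))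
      = z i ^ (n i / ((q i : ℕ) : ℤ)) * (if i = j then z j else 1) := by
    intro i
    by_cases h : i = j
    · subst h
      simp [Int.add_ediv_of_dvd_right, zpow_add_one₀ (hz i)]
    · simp [h]
  have h2 : (fun i => fem (q i) ((n + Pi.single j ((q j : ℕ) : ℤ) : Fin d → ℤ) i))
      = fun i => fem (q i) (n i) := by
    funext i
    by_cases h : i = j
    · subst h
      simp [fem]
    · simp [h]
  simp only [extendBC, h1, h2, Finset.prod_mul_distrib, Finset.prod_ite_eq', Finset.mem_univ,
    if_true]
  ring

theorem extendBC_apply_val (q : Fin d → ℕ+) (z : Fin d → ℂ) (v : (∀ j, Fin (q j : ℕ)) → ℂ)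
    (m : ∀ j, Fin (q j : ℕ)) : extendBC q z v (fun j => ((m j : ℕ) : ℤ)) = v m := by
  have h1 : ∀ j, ((m j : ℕ) : ℤ) / ((q j : ℕ) : ℤ) = 0 := fun j =>
    Int.ediv_eq_zero_of_lt (by positivity) (by exact_mod_cast (m j).2)
  have h2 : (fun j => fem (q j) ((m j : ℕ) : ℤ)) = m := by
    funext j
    apply Fin.ext
    have := fem_val (q j) ((m j : ℕ) : ℤ)
    rw [Int.emod_eq_of_lt (by positivity) (by exact_mod_cast (m j).2)] at this
    exact_mod_cast this
  simp only [extendBC, h1, h2, zpow_zero, Finset.prod_const_one, one_mul]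

theorem QuasiPeriodic.discLap {q : Fin d → ℕ+} {z : Fin d → ℂ} {u : (Fin d → ℤ) → ℂ}
    (hu : QuasiPeriodic q z u) : QuasiPeriodic q z (discLap u) := by
  intro n j
  simp only [discLap_eq_sum, Finset.mul_sum, mul_add]
  refine Finset.sum_congr rfl fun i _ => ?_
  rw [← hu, ← hu]
  simp only [add_right_comm]

theorem DVmat_mulVec (q : Fin d → ℕ+) (V : (Fin d → ℤ) → ℂ) (z : Fin d → ℂ)
    (v : (∀ j, Fin (q j : ℕ)) → ℂ) (m : ∀ j, Fin (q j : ℕ)) :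
    (DVmat q V z).mulVec v m = -(discLap (extendBC q z v) (fun j => ((m j : ℕ) : ℤ)))
      + V (fun j => ((m j : ℕ) : ℤ)) * v m := by
  have hext : ∀ n, extendBC q z v n = ∑ m', extendBC q z (Pi.single m' 1) n * v m' := by
    intro n
    simp only [extendBC, Pi.single_apply, mul_assoc, ← Finset.mul_sum, ite_mul, one_mul, zero_mul,
      Finset.sum_ite_eq, Finset.mem_univ, if_true]
  have hlap : ∀ n, discLap (extendBC q z v) n
      = ∑ m', discLap (extendBC q z (Pi.single m' 1)) n * v m' := by
    intro n
    simp only [discLap, hext, Finset.sum_mul, add_mul, ← Finset.sum_add_distrib]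
    rw [Finset.sum_comm]
  rw [hlap]
  simp only [Matrix.mulVec, dotProduct, DVmat, add_mul, neg_mul, Finset.sum_add_distrib,
    Finset.sum_neg_distrib, mul_ite, ite_mul, mul_one, mul_zero, zero_mul, Finset.sum_ite_eq,
    Finset.mem_univ, if_true]

theorem mem_spectrum_DVmat_iff {q : Fin d → ℕ+} {V : (Fin d → ℤ) → ℂ} {z : Fin d → ℂ}
    (hz : ∀ j, z j ≠ 0) (hV : QuasiPeriodic q 1 V) (lam : ℂ) :
    lam ∈ spectrum ℂ (DVmat q V z) ↔ HasFloquetSolution q V z lam := by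
  rw [← Matrix.spectrum_toLin', ← Module.End.hasEigenvalue_iff_mem_spectrum]
  constructor
  · intro h
    obtain ⟨v, hv⟩ := h.exists_hasEigenvector
    have hv1 := hv.apply_eq_smul
    rw [Matrix.toLin'_apply] at hv1
    have hqp := quasiPeriodic_extendBC hz v
    refine ⟨extendBC q z v, ?_, ?_, hqp⟩
    · intro h0
      refine hv.2 (funext fun m => ?_)
      rw [← extendBC_apply_val q z v m, h0]; rfl
    · have hr : (fun n => -(discLap (extendBC q z v) n) + V n * extendBC q z v n
          - lam * extendBC q z v n) = 0 := by
        refine QuasiPeriodic.eq_zero (q := q) hz ?_ ?_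
        · intro n j
          have h1 := hqp.discLap n j
          have h2 := hqp n j
          have h3 := hV n j
          simp only [Pi.one_apply, one_mul] at h3
          simp only [h1, h2, h3]
          ring
        · intro m
          have := congrFun hv1 m
          rw [DVmat_mulVec] at this
          simp only [extendBC_apply_val, this, Pi.smul_apply, smul_eq_mul, sub_self]
      exact fun n => sub_eq_zero.1 (congrFun hr n)
  · rintro ⟨u, hu0, hu, hqp⟩
    refine Module.End.hasEigenvalue_of_hasEigenvector
      (x := fun m => u (fun j => ((m j : ℕ) : ℤ))) ⟨?_, ?_⟩
    · rw [Module.End.mem_eigenspace_iff, Matrix.toLin'_apply]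
      funext m
      rw [DVmat_mulVec, ← hqp.eq_extendBC hz, hu]
      rfl
    · intro h0
      exact hu0 (hqp.eq_zero hz fun m => congrFun h0 m)

end Floquet

section Gauge

variable {d : ℕ}

theorem QuasiPeriodic.eq_cast {q : Fin d → ℕ+} {u : (Fin d → ℤ) → ℂ} (hu : QuasiPeriodic q 1 u)
    (n : Fin d → ℤ) : u n = u (fun j => ((n j : ZMod (q j : ℕ)).cast : ℤ)) := by
  rw [hu.eq_prod_mul (fun j => one_ne_zero) n]
  simp [ZMod.coe_intCast]

theorem discLap_gauge {q : Fin d → ℕ+} {w : Fin d → ℂ} (hw : ∀ j, w j ≠ 0)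
    (p : (∀ j, ZMod (q j : ℕ)) → ℂ) (n : Fin d → ℤ) :
    discLap (fun n => (∏ j, w j ^ n j) * p (fun j => (n j : ZMod (q j : ℕ)))) n =
      (∏ j, w j ^ n j) * ∑ j, (w j * p ((fun i => (n i : ZMod (q i : ℕ))) + Pi.single j 1) +
        (w j)⁻¹ * p ((fun i => (n i : ZMod (q i : ℕ))) - Pi.single j 1)) := by
  have h1 : ∀ (j : Fin d) (a : ℤ), (∏ i, w i ^ ((n + Pi.single j a : Fin d → ℤ) i))
      = (∏ i, w i ^ n i) * w j ^ a := by
    intro j a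
    have : ∀ i, w i ^ ((n + Pi.single j a : Fin d → ℤ) i)
        = w i ^ n i * (if i = j then w j ^ a else 1) := by
      intro i
      by_cases h : i = j
      · subst h; simp [zpow_add₀ (hw i)]
      · simp [h]
    simp only [this, Finset.prod_mul_distrib, Finset.prod_ite_eq', Finset.mem_univ, if_true]
  have h2 : ∀ (j : Fin d) (a : ℤ),
      (fun i => (((n + Pi.single j a : Fin d → ℤ) i : ℤ) : ZMod (q i : ℕ)))
      = (fun i => (n i : ZMod (q i : ℕ))) + Pi.single j (a : ZMod (q j : ℕ)) := by
    intro j a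
    funext i
    by_cases h : i = j
    · subst h; simp
    · simp [h]
  rw [discLap_eq_sum, Finset.mul_sum]
  refine Finset.sum_congr rfl fun j _ => ?_
  simp only [h1, h2]
  simp only [zpow_one, zpow_neg, Int.cast_one, Int.cast_neg, Pi.single_neg]
  rw [← sub_eq_add_neg]
  ring

theorem hasFloquetSolution_pow_iff {q : Fin d → ℕ+} {V : (Fin d → ℤ) → ℂ}
    (hV : QuasiPeriodic q 1 V) {w : Fin d → ℂ} (hw : ∀ j, w j ≠ 0) (lam : ℂ) :
    HasFloquetSolution q V (fun j => w j ^ (q j : ℕ)) lam ↔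
      ∃ p : (∀ j, ZMod (q j : ℕ)) → ℂ, p ≠ 0 ∧ ∀ g,
        -(∑ j, (w j * p (g + Pi.single j 1) + (w j)⁻¹ * p (g - Pi.single j 1)))
          + V (fun j => ((g j).cast : ℤ)) * p g = lam * p g := by
  have hM : ∀ n : Fin d → ℤ, (∏ j, w j ^ n j) ≠ 0 := fun n =>
    Finset.prod_ne_zero_iff.2 fun j _ => zpow_ne_zero _ (hw j)
  have hMq : QuasiPeriodic q (fun j => w j ^ (q j : ℕ)) (fun n => ∏ j, w j ^ n j) := by
    intro n j
    have : ∀ i, w i ^ ((n + Pi.single j ((q j : ℕ) : ℤ) : Fin d → ℤ) i)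
        = (if i = j then w j ^ (q j : ℕ) else 1) * w i ^ n i := by
      intro i
      by_cases h : i = j
      · subst h; simp [zpow_add₀ (hw i), mul_comm]
      · simp [h]
    simp only [this, Finset.prod_mul_distrib, Finset.prod_ite_eq', Finset.mem_univ, if_true]
  have hcast : ∀ g : ∀ j, ZMod (q j : ℕ), (fun j => (((g j).cast : ℤ) : ZMod (q j : ℕ))) = g :=
    fun g => funext fun j => ZMod.intCast_zmod_cast _
  constructor
  · rintro ⟨u, hu0, hu, hqp⟩
    set p : (∀ j, ZMod (q j : ℕ)) → ℂ := fun g =>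
      (∏ j, w j ^ ((g j).cast : ℤ))⁻¹ * u (fun j => ((g j).cast : ℤ)) with hp
    have hper : QuasiPeriodic q 1 (fun n => (∏ j, w j ^ n j)⁻¹ * u n) := by
      intro n j
      have h1 := hMq n j
      have h2 := hqp n j
      simp only at h1 h2 ⊢
      rw [h1, h2]
      have := hw j
      have := hM n
      simp only [Pi.one_apply, one_mul]
      field_simp
    have hup : u = fun n => (∏ j, w j ^ n j) * p (fun j => (n j : ZMod (q j : ℕ))) := by
      funext n
      have := hper.eq_cast n
      simp only at this
      rw [hp]
      simp only
      rw [← this, mul_inv_cancel_left₀ (hM n)]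
    refine ⟨p, ?_, ?_⟩
    · intro h0
      apply hu0
      rw [hup, h0]
      funext n; simp
    · intro g
      have := hu (fun j => ((g j).cast : ℤ))
      rw [hup, discLap_gauge hw] at this
      simp only [hcast] at this
      refine mul_left_cancel₀ (hM (fun j => ((g j).cast : ℤ))) ?_
      linear_combination this
  · rintro ⟨p, hp0, hp⟩
    refine ⟨fun n => (∏ j, w j ^ n j) * p (fun j => (n j : ZMod (q j : ℕ))), ?_, ?_, ?_⟩
    · intro h0
      apply hp0
      funext g
      have := congrFun h0 (fun j => ((g j).cast : ℤ))
      simp only [hcast, Pi.zero_apply] at this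
      exact (mul_eq_zero.1 this).resolve_left (hM _)
    · intro n
      rw [discLap_gauge hw, hV.eq_cast n]
      linear_combination (∏ j, w j ^ n j) * hp (fun j => (n j : ZMod (q j : ℕ)))
    · intro n j
      have h1 := hMq n j
      have h2 : (fun i => (((n + Pi.single j ((q j : ℕ) : ℤ) : Fin d → ℤ) i : ℤ)
          : ZMod (q i : ℕ))) = (fun i => (n i : ZMod (q i : ℕ))) := by
        funext i
        by_cases h : i = j
        · subst h; simp
        · simp [h]
      simp only at h1 ⊢
      rw [h1, h2, mul_assoc]

end Gauge

section Separable

variable {d d₁ d₂ : ℕ}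

/-- Translation by `a`, as a linear map on functions on `ℤ^d`. -/
def translation (a : Fin d → ℤ) : Module.End ℂ ((Fin d → ℤ) → ℂ) :=
  LinearMap.funLeft ℂ ℂ (· + a)

@[simp] theorem translation_apply (a : Fin d → ℤ) (u : (Fin d → ℤ) → ℂ) (n : Fin d → ℤ) :
    translation a u n = u (n + a) := rfl

theorem commute_translation (a b : Fin d → ℤ) : Commute (translation a) (translation b) := by
  refine LinearMap.ext fun u => funext fun n => ?_
  simp [add_right_comm]

theorem commute_translation_mulLeft {a : Fin d → ℤ} {W : (Fin d → ℤ) → ℂ}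
    (h : ∀ n, W (n + a) = W n) : Commute (translation a) (LinearMap.mulLeft ℂ W) := by
  refine LinearMap.ext fun u => funext fun n => ?_
  simp [h]

/-- The discrete Schrödinger operator with potential `W`, with hopping only in the directions
`e i`. -/
def hopping {ι : Type*} [Fintype ι] (e : ι → Fin d) (W : (Fin d → ℤ) → ℂ) :
    Module.End ℂ ((Fin d → ℤ) → ℂ) :=
  -(∑ i, (translation (Pi.single (e i) 1) + translation (Pi.single (e i) (-1))))
    + LinearMap.mulLeft ℂ W

theorem hopping_apply {ι : Type*} [Fintype ι] (e : ι → Fin d) (W u : (Fin d → ℤ) → ℂ)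
    (n : Fin d → ℤ) : hopping e W u n =
      -(∑ i, (u (n + Pi.single (e i) 1) + u (n + Pi.single (e i) (-1)))) + W n * u n := by
  simp [hopping, LinearMap.sum_apply]

theorem commute_translation_hopping {ι : Type*} [Fintype ι] (e : ι → Fin d) {a : Fin d → ℤ}
    {W : (Fin d → ℤ) → ℂ} (h : ∀ n, W (n + a) = W n) :
    Commute (translation a) (hopping e W) := by
  refine Commute.add_right (Commute.neg_right (Commute.sum_right _ _ _ fun i _ => ?_))
    (commute_translation_mulLeft h)
  exact (commute_translation _ _).add_right (commute_translation _ _)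

theorem commute_hopping {ι κ : Type*} [Fintype ι] [Fintype κ] (e : ι → Fin d) (f : κ → Fin d)
    {W X : (Fin d → ℤ) → ℂ} (hW : ∀ n j a, W (n + Pi.single (f j) a) = W n)
    (hX : ∀ n i a, X (n + Pi.single (e i) a) = X n) :
    Commute (hopping e W) (hopping f X) := by
  refine Commute.add_left (Commute.neg_left (Commute.sum_left _ _ _ fun i _ => ?_)) ?_
  · exact (commute_translation_hopping f fun n => hX n i 1).add_left
      (commute_translation_hopping f fun n => hX n i (-1))
  · refine Commute.add_right (Commute.neg_right (Commute.sum_right _ _ _ fun j _ => ?_)) ?_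
    · exact (commute_translation_mulLeft fun n => hW n j 1).symm.add_right
        (commute_translation_mulLeft fun n => hW n j (-1)).symm
    · refine LinearMap.ext fun u => funext fun n => ?_
      simp [mul_left_comm]

theorem add_single_castAdd_left (n : Fin (d₁ + d₂) → ℤ) (j : Fin d₁) (a : ℤ) :
    (fun i => (n + Pi.single (Fin.castAdd d₂ j) a : Fin (d₁ + d₂) → ℤ) (Fin.castAdd d₂ i))
      = (fun i => n (Fin.castAdd d₂ i)) + Pi.single j a := by
  funext i
  by_cases h : i = j
  · subst h; simp
  · have h' : (i : ℕ) ≠ j := Fin.val_ne_of_ne h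
    simp [h, Fin.ext_iff, h']

theorem add_single_castAdd_right (n : Fin (d₁ + d₂) → ℤ) (j : Fin d₁) (a : ℤ) :
    (fun i => (n + Pi.single (Fin.castAdd d₂ j) a : Fin (d₁ + d₂) → ℤ) (Fin.natAdd d₁ i))
      = fun i => n (Fin.natAdd d₁ i) := by
  funext i
  have h : Fin.natAdd d₁ i ≠ Fin.castAdd d₂ j := by
    simp only [ne_eq, Fin.ext_iff, Fin.val_natAdd, Fin.val_castAdd]
    have := j.2
    omega
  simp [h]

theorem add_single_natAdd_left (n : Fin (d₁ + d₂) → ℤ) (j : Fin d₂) (a : ℤ) :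
    (fun i => (n + Pi.single (Fin.natAdd d₁ j) a : Fin (d₁ + d₂) → ℤ) (Fin.castAdd d₂ i))
      = fun i => n (Fin.castAdd d₂ i) := by
  funext i
  have h : Fin.castAdd d₂ i ≠ Fin.natAdd d₁ j := by
    simp only [ne_eq, Fin.ext_iff, Fin.val_natAdd, Fin.val_castAdd]
    have := i.2
    omega
  simp [h]

theorem add_single_natAdd_right (n : Fin (d₁ + d₂) → ℤ) (j : Fin d₂) (a : ℤ) :
    (fun i => (n + Pi.single (Fin.natAdd d₁ j) a : Fin (d₁ + d₂) → ℤ) (Fin.natAdd d₁ i))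
      = (fun i => n (Fin.natAdd d₁ i)) + Pi.single j a := by
  funext i
  by_cases h : i = j
  · subst h; simp
  · have h' : (i : ℕ) ≠ j := Fin.val_ne_of_ne h
    simp [h, Fin.ext_iff, h']

theorem append_add_single_left (a : Fin d₁ → ℤ) (b : Fin d₂ → ℤ) (j : Fin d₁) (x : ℤ) :
    Fin.append a b + Pi.single (Fin.castAdd d₂ j) x = Fin.append (a + Pi.single j x) b := by
  funext k
  refine Fin.addCases (fun i => ?_) (fun i => ?_) k
  · have := congrFun (add_single_castAdd_left (Fin.append a b) j x) i
    simpa only [Fin.append_left, Fin.append_right] using this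
  · have := congrFun (add_single_castAdd_right (Fin.append a b) j x) i
    simpa only [Fin.append_left, Fin.append_right] using this

theorem append_add_single_right (a : Fin d₁ → ℤ) (b : Fin d₂ → ℤ) (j : Fin d₂) (x : ℤ) :
    Fin.append a b + Pi.single (Fin.natAdd d₁ j) x = Fin.append a (b + Pi.single j x) := by
  funext k
  refine Fin.addCases (fun i => ?_) (fun i => ?_) k
  · have := congrFun (add_single_natAdd_left (Fin.append a b) j x) i
    simpa only [Fin.append_left, Fin.append_right] using this
  · have := congrFun (add_single_natAdd_right (Fin.append a b) j x) i
    simpa only [Fin.append_left, Fin.append_right] using this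

theorem HasFloquetSolution.separable {q : Fin (d₁ + d₂) → ℕ+} {V₁ : (Fin d₁ → ℤ) → ℂ}
    {V₂ : (Fin d₂ → ℤ) → ℂ} {z : Fin (d₁ + d₂) → ℂ} {lam nu : ℂ}
    (h₁ : HasFloquetSolution (fun i => q (Fin.castAdd d₂ i)) V₁ (fun i => z (Fin.castAdd d₂ i))
      (lam - nu))
    (h₂ : HasFloquetSolution (fun i => q (Fin.natAdd d₁ i)) V₂ (fun i => z (Fin.natAdd d₁ i)) nu) :
    HasFloquetSolution q (fun n => V₁ (fun i => n (Fin.castAdd d₂ i))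
      + V₂ (fun i => n (Fin.natAdd d₁ i))) z lam := by
  obtain ⟨u, hu0, hu, hqu⟩ := h₁
  obtain ⟨v, hv0, hv, hqv⟩ := h₂
  refine ⟨fun n => u (fun i => n (Fin.castAdd d₂ i)) * v (fun i => n (Fin.natAdd d₁ i)),
    ?_, ?_, ?_⟩
  · obtain ⟨a, ha⟩ := Function.ne_iff.1 hu0
    obtain ⟨b, hb⟩ := Function.ne_iff.1 hv0
    intro h0
    have := congrFun h0 (Fin.append a b)
    simp only [Fin.append_left, Fin.append_right] at this
    exact (mul_ne_zero ha hb) this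
  · intro n
    have e1 := hu (fun i => n (Fin.castAdd d₂ i))
    have e2 := hv (fun i => n (Fin.natAdd d₁ i))
    rw [discLap_eq_sum] at e1 e2 ⊢
    rw [Fin.sum_univ_add]
    simp only [add_single_castAdd_left, add_single_castAdd_right, add_single_natAdd_left,
      add_single_natAdd_right, ← add_mul, ← mul_add, ← Finset.sum_mul, ← Finset.mul_sum]
    linear_combination v (fun i => n (Fin.natAdd d₁ i)) * e1
      + u (fun i => n (Fin.castAdd d₂ i)) * e2
  · intro n j
    refine Fin.addCases (fun i => ?_) (fun i => ?_) j
    · simp only [add_single_castAdd_left, add_single_castAdd_right]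
      have := hqu (fun i => n (Fin.castAdd d₂ i)) i
      simp only at this
      rw [this, mul_assoc]
    · simp only [add_single_natAdd_left, add_single_natAdd_right]
      have := hqv (fun i => n (Fin.natAdd d₁ i)) i
      simp only at this
      rw [this, mul_left_comm]

theorem HasFloquetSolution.exists_of_separable {q : Fin (d₁ + d₂) → ℕ+} {V₁ : (Fin d₁ → ℤ) → ℂ}
    {V₂ : (Fin d₂ → ℤ) → ℂ} (hV₂ : QuasiPeriodic (fun i => q (Fin.natAdd d₁ i)) 1 V₂)
    {z : Fin (d₁ + d₂) → ℂ} (hz : ∀ j, z j ≠ 0) {lam : ℂ}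
    (h : HasFloquetSolution q (fun n => V₁ (fun i => n (Fin.castAdd d₂ i))
      + V₂ (fun i => n (Fin.natAdd d₁ i))) z lam) :
    ∃ nu, HasFloquetSolution (fun i => q (Fin.castAdd d₂ i)) V₁ (fun i => z (Fin.castAdd d₂ i))
        (lam - nu) ∧
      HasFloquetSolution (fun i => q (Fin.natAdd d₁ i)) V₂ (fun i => z (Fin.natAdd d₁ i)) nu := by
  obtain ⟨u, hu0, hu, hqu⟩ := h
  set H₁ := hopping (Fin.castAdd d₂ : Fin d₁ → _) (fun n => V₁ (fun i => n (Fin.castAdd d₂ i)))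
    with hH₁
  set H₂ := hopping (Fin.natAdd d₁ : Fin d₂ → _) (fun n => V₂ (fun i => n (Fin.natAdd d₁ i)))
    with hH₂
  have hH : ∀ f n, (H₁ + H₂) f n = -(discLap f n) + (V₁ (fun i => n (Fin.castAdd d₂ i))
      + V₂ (fun i => n (Fin.natAdd d₁ i))) * f n := by
    intro f n
    rw [discLap_eq_sum, Fin.sum_univ_add, LinearMap.add_apply, Pi.add_apply, hopping_apply,
      hopping_apply]
    ring
  have hcomm : Commute H₂ (H₁ + H₂) := by
    refine Commute.add_right ?_ (Commute.refl _)
    refine commute_hopping _ _ (fun n j a => ?_) (fun n j a => ?_)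
    · rw [add_single_castAdd_right]
    · rw [add_single_natAdd_left]
  have hT : ∀ j, Commute H₂ (translation (Pi.single j ((q j : ℕ) : ℤ))) := by
    intro j
    refine (commute_translation_hopping _ fun n => ?_).symm
    refine Fin.addCases (fun i => ?_) (fun i => ?_) j
    · rw [add_single_castAdd_right]
    · rw [add_single_natAdd_right]
      simpa using hV₂ (fun i => n (Fin.natAdd d₁ i)) i
  set K : Submodule ℂ ((Fin (d₁ + d₂) → ℤ) → ℂ) := Module.End.eigenspace (H₁ + H₂) lam ⊓
    ⨅ j, Module.End.eigenspace (translation (Pi.single j ((q j : ℕ) : ℤ))) (z j) with hK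
  have hKq : ∀ f ∈ K, QuasiPeriodic q z f := by
    intro f hf n j
    have := (Submodule.mem_iInf _).1 hf.2 j
    exact congrFun (Module.End.mem_eigenspace_iff.1 this) n
  have huK : u ∈ K := by
    refine ⟨Module.End.mem_eigenspace_iff.2 (funext fun n => ?_),
      (Submodule.mem_iInf _).2 fun j => Module.End.mem_eigenspace_iff.2 (funext fun n => hqu n j)⟩
    rw [hH, hu]; rfl
  have hinv : ∀ f ∈ K, H₂ f ∈ K := by
    intro f hf
    have key : ∀ (T : Module.End ℂ ((Fin (d₁ + d₂) → ℤ) → ℂ)) (c : ℂ), Commute H₂ T →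
        f ∈ Module.End.eigenspace T c → H₂ f ∈ Module.End.eigenspace T c := by
      intro T c hc hf
      rw [Module.End.mem_eigenspace_iff] at hf ⊢
      rw [← Module.End.mul_apply, ← hc.eq, Module.End.mul_apply, hf, map_smul]
    exact ⟨key _ _ hcomm hf.1, (Submodule.mem_iInf _).2 fun j =>
      key _ _ (hT j) ((Submodule.mem_iInf _).1 hf.2 j)⟩
  have hfin : FiniteDimensional ℂ K := by
    refine FiniteDimensional.of_injective ((LinearMap.funLeft ℂ ℂ
      (fun (m : ∀ j, Fin (q j : ℕ)) j => ((m j : ℕ) : ℤ))).comp K.subtype) ?_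
    rw [injective_iff_map_eq_zero]
    intro f hf
    exact Subtype.ext ((hKq f f.2).eq_zero hz fun m => congrFun hf m)
  have : Nontrivial K := ⟨⟨⟨u, huK⟩, 0, fun h => hu0 (congrArg Subtype.val h)⟩⟩
  obtain ⟨nu, hnu⟩ := Module.End.exists_eigenvalue (H₂.restrict hinv)
  obtain ⟨⟨f, hfK⟩, hf⟩ := hnu.exists_hasEigenvector
  have hf0 : f ≠ 0 := fun h => hf.2 (Subtype.ext h)
  have hf2 : H₂ f = nu • f := congrArg Subtype.val hf.apply_eq_smul
  have hf1 : H₁ f = (lam - nu) • f := by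
    have := Module.End.mem_eigenspace_iff.1 hfK.1
    rw [LinearMap.add_apply, hf2] at this
    rw [sub_smul, ← this, add_sub_cancel_right]
  have hfq := hKq f hfK
  obtain ⟨n, hn⟩ := Function.ne_iff.1 hf0
  set a : Fin d₁ → ℤ := fun i => n (Fin.castAdd d₂ i) with ha
  set b : Fin d₂ → ℤ := fun i => n (Fin.natAdd d₁ i) with hb
  have hab : Fin.append a b = n := Fin.append_castAdd_natAdd
  refine ⟨nu, ⟨fun a' => f (Fin.append a' b), ?_, ?_, ?_⟩,
    ⟨fun b' => f (Fin.append a b'), ?_, ?_, ?_⟩⟩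
  · intro h0
    exact hn (by simpa [hab] using congrFun h0 a)
  · intro a'
    have := congrFun hf1 (Fin.append a' b)
    simpa [hH₁, hopping_apply, discLap_eq_sum, append_add_single_left] using this
  · intro a' j
    simpa [append_add_single_left] using hfq (Fin.append a' b) (Fin.castAdd d₂ j)
  · intro h0
    exact hn (by simpa [hab] using congrFun h0 b)
  · intro b'
    have := congrFun hf2 (Fin.append a b')
    simpa [hH₂, hopping_apply, discLap_eq_sum, append_add_single_right] using this
  · intro b' j
    simpa [append_add_single_right] using hfq (Fin.append a b') (Fin.natAdd d₁ j)

end Separable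

section Pencil

open Topology

variable {d : ℕ}

/-- A direction `α` with nonzero coordinates summing to zero, such that `∑ⱼ αⱼ ρⱼ` vanishes for no
nontrivial tuple of `q j`-th roots of unity `ρⱼ`. -/
structure IsGenericDirection (q : Fin d → ℕ+) (α : Fin d → ℂ) : Prop where
  ne_zero : ∀ j, α j ≠ 0
  sum_eq_zero : ∑ j, α j = 0
  eq_one : ∀ ρ : Fin d → ℂ, (∀ j, ρ j ^ (q j : ℕ) = 1) → ∑ j, α j * ρ j = 0 → ρ = 1

theorem exists_isGenericDirection (hd : 2 ≤ d) (q : Fin d → ℕ+)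
    (hq : ∀ i j, i ≠ j → Nat.Coprime (q i) (q j)) : ∃ α, IsGenericDirection q α := by
  have : Nontrivial (Fin d) := Fin.nontrivial_iff_two_le.2 hd
  have hfin : Finite {ρ : Fin d → ℂ // (∀ j, ρ j ^ (q j : ℕ) = 1) ∧ ρ ≠ 1} := by
    refine Set.Finite.subset (s := {ρ : Fin d → ℂ | ∀ j, ρ j ∈ {x : ℂ | x ^ (q j : ℕ) = 1}})
      (Set.Finite.pi' fun j => ?_) fun ρ hρ => hρ.1
    refine (Polynomial.nthRootsFinset (q j : ℕ) (1 : ℂ)).finite_toSet.subset fun x hx => ?_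
    exact (Polynomial.mem_nthRootsFinset (q j).pos (1 : ℂ)).2 hx
  obtain ⟨α, hα, h⟩ := Module.Dual.exists_forall_mem_ne_zero_of_forall_exists
    (LinearMap.ker (∑ j, LinearMap.proj j : (Fin d → ℂ) →ₗ[ℂ] ℂ))
    (Sum.elim (fun j => LinearMap.proj j)
      (fun ρ : {ρ : Fin d → ℂ // (∀ j, ρ j ^ (q j : ℕ) = 1) ∧ ρ ≠ 1} =>
        ∑ j, (ρ : Fin d → ℂ) j • LinearMap.proj j)) (by
    rintro (j | ⟨ρ, hρ, hne⟩)
    · obtain ⟨k, hk⟩ := exists_ne j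
      refine ⟨Pi.single j 1 - Pi.single k 1, ?_, ?_⟩
      · simp [LinearMap.sum_apply]
      · simp [hk.symm]
    · have : ∃ i j, ρ i ≠ ρ j := by
        by_contra! hall
        refine hne (funext fun i => ?_)
        obtain ⟨j, hj⟩ := exists_ne i
        have h1 := pow_gcd_eq_one.2 ⟨hρ i, hall i j ▸ hρ j⟩
        rwa [hq i j hj.symm, pow_one] at h1
      obtain ⟨i, j, hij⟩ := this
      refine ⟨Pi.single i 1 - Pi.single j 1, ?_, ?_⟩
      · simp [LinearMap.sum_apply]
      · simpa [LinearMap.sum_apply, mul_sub, Finset.sum_sub_distrib, Pi.single_apply, sub_eq_zero]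
          using hij)
  refine ⟨α, fun j => h (Sum.inl j), by simpa using hα, fun ρ hρ h0 => ?_⟩
  by_contra hne
  refine h (Sum.inr ⟨ρ, hρ, hne⟩) ?_
  simpa [LinearMap.sum_apply, mul_comm] using h0

/-- Translation by `a` on functions on a finite group. -/
def shift {G : Type*} [AddCommGroup G] [Finite G] (a : G) : (G → ℂ) →L[ℂ] (G → ℂ) :=
  LinearMap.toContinuousLinearMap (LinearMap.funLeft ℂ ℂ (· + a))

@[simp] theorem shift_apply {G : Type*} [AddCommGroup G] [Finite G] (a : G) (p : G → ℂ) (g : G) :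
    shift a p g = p (g + a) := rfl

/-- The average of a function on a finite group. -/
def average (G : Type*) [Fintype G] : (G → ℂ) →L[ℂ] ℂ :=
  (Fintype.card G : ℂ)⁻¹ • ∑ g, ContinuousLinearMap.proj g

theorem average_apply {G : Type*} [Fintype G] (p : G → ℂ) :
    average G p = (Fintype.card G : ℂ)⁻¹ * ∑ g, p g := by
  simp [average]

theorem average_shift {G : Type*} [AddCommGroup G] [Fintype G] (a : G) (p : G → ℂ) :
    average G (shift a p) = average G p := by
  simp only [average_apply, shift_apply]
  congr 1
  exact Equiv.sum_comp (Equiv.addRight a) p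

theorem average_one {G : Type*} [AddCommGroup G] [Fintype G] : average G 1 = 1 := by
  simp [average_apply]

theorem shift_one {G : Type*} [AddCommGroup G] [Finite G] (a : G) : shift a 1 = 1 := rfl

theorem eq_zero_of_sum_shift_eq_zero {G ι : Type*} [AddCommGroup G] [Fintype G] [Fintype ι]
    (a : ι → G) (α : ι → ℂ) (h : ∀ χ : AddChar G ℂ, ∑ j, α j * χ (a j) = 0 → χ = 0)
    {p : G → ℂ} (hp : (∑ j, α j • shift (a j)) p = 0) (hp0 : average G p = 0) : p = 0 := by
  set b := AddChar.complexBasis G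
  have hb : ∀ χ, (∑ j, α j • shift (a j)) (b χ) = (∑ j, α j * χ (a j)) • b χ := by
    intro χ
    funext g
    simp [b, AddChar.map_add_eq_mul, Finset.sum_mul, mul_assoc, mul_comm (χ g)]
  have hp' := b.sum_repr p
  have hc : ∀ χ, χ ≠ 0 → b.repr p χ = 0 := by
    intro χ hχ
    rw [← hp', map_sum] at hp
    simp only [map_smul, hb, smul_smul] at hp
    exact (mul_eq_zero.1 (Fintype.linearIndependent_iff.1 b.linearIndependent _ hp χ)).resolve_right
      fun h0 => hχ (h χ h0)
  rw [Finset.sum_eq_single 0 (fun χ _ hχ => by rw [hc χ hχ, zero_smul]) (by simp)] at hp'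
  have hb0 : b 0 = 1 := by
    funext g
    simp [b]
  rw [hb0] at hp'
  rw [← hp', map_smul, average_one, smul_eq_mul, mul_one] at hp0
  rw [← hp', hp0, zero_smul]

theorem IsGenericDirection.addChar_eq_zero {q : Fin d → ℕ+} {α : Fin d → ℂ}
    (hα : IsGenericDirection q α) (χ : AddChar (∀ j, ZMod (q j : ℕ)) ℂ)
    (h : ∑ j, α j * χ (Pi.single j 1) = 0) : χ = 0 := by
  have h1 := hα.eq_one (fun j => χ (Pi.single j 1)) (fun j => by
    rw [← AddChar.map_nsmul_eq_pow, ← Pi.single_smul]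
    simp) h
  ext g
  have hg : g = ∑ j, (g j).val • (Pi.single j 1 : ∀ j, ZMod (q j : ℕ)) := by
    conv_lhs => rw [← Finset.univ_sum_single g]
    refine Finset.sum_congr rfl fun j _ => ?_
    rw [← Pi.single_smul]
    simp
  have hs : ∀ s : Finset (Fin d),
      χ (∑ j ∈ s, (g j).val • (Pi.single j 1 : ∀ j, ZMod (q j : ℕ))) = 1 := by
    intro s
    induction s using Finset.induction_on with
    | empty => simp
    | insert a s ha ih =>
      rw [Finset.sum_insert ha, AddChar.map_add_eq_mul, ih, AddChar.map_nsmul_eq_pow,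
        congrFun h1 a]
      simp
  rw [hg, hs, AddChar.zero_apply]

/-- The multipliers `αⱼ / τ + s δ_{j i}` at `x = (τ, s)`. -/
def multiplierRoot (α : Fin d → ℂ) (i : Fin d) (x : ℂ × ℂ) (j : Fin d) : ℂ :=
  α j / x.1 + if j = i then x.2 else 0

/-- After multiplication by `τ`, the Floquet eigenvalue equation at the multipliers
`multiplierRoot α i (τ, s)` becomes `∑ⱼ αⱼ p(g + eⱼ) = τ • pencil (τ, s) p`. -/
def pencil (q : Fin d → ℕ+) (α : Fin d → ℂ) (i : Fin d) (v : (∀ j, ZMod (q j : ℕ)) → ℂ) (lam : ℂ)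
    (x : ℂ × ℂ) : ((∀ j, ZMod (q j : ℕ)) → ℂ) →L[ℂ] ((∀ j, ZMod (q j : ℕ)) → ℂ) :=
  ContinuousLinearMap.mul ℂ _ v - lam • ContinuousLinearMap.id ℂ _ - x.2 • shift (Pi.single i 1)
    - ∑ j, (x.1 * (α j + x.1 * (if j = i then x.2 else 0))⁻¹) • shift (-Pi.single j 1)

theorem contDiffAt_pencil {q : Fin d → ℕ+} {α : Fin d → ℂ} (hα : ∀ j, α j ≠ 0) (i : Fin d)
    (v : (∀ j, ZMod (q j : ℕ)) → ℂ) (lam s : ℂ) :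
    ContDiffAt ℂ 1 (pencil q α i v lam) (0, s) := by
  unfold pencil
  refine ContDiffAt.sub (by fun_prop) (ContDiffAt.sum fun j _ => ?_)
  refine ContDiffAt.smul (contDiffAt_fst.mul (ContDiffAt.inv ?_ (by simpa using hα j)))
    contDiffAt_const
  split_ifs <;> fun_prop

theorem pencil_zero (q : Fin d → ℕ+) (α : Fin d → ℂ) (i : Fin d)
    (v : (∀ j, ZMod (q j : ℕ)) → ℂ) (lam s : ℂ) : pencil q α i v lam (0, s) =
      (ContinuousLinearMap.mul ℂ _ v - lam • ContinuousLinearMap.id ℂ _)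
        - s • shift (Pi.single i 1) := by
  have : ∀ a : (∀ j, ZMod (q j : ℕ)), (0 : ℂ) • shift a = 0 := fun a =>
    ContinuousLinearMap.ext fun p => by simp
  simp [pencil, this]

theorem average_mul_sub_smul_one (q : Fin d → ℕ+) (v : (∀ j, ZMod (q j : ℕ)) → ℂ) (lam : ℂ) :
    average _ ((ContinuousLinearMap.mul ℂ ((∀ j, ZMod (q j : ℕ)) → ℂ) v
      - lam • ContinuousLinearMap.id ℂ ((∀ j, ZMod (q j : ℕ)) → ℂ)) 1)
      = average _ v - lam := by
  simp [average_one]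

theorem eventually_multiplierRoot_ne_zero {α : Fin d → ℂ} (hα : ∀ j, α j ≠ 0) (i : Fin d) (s : ℂ) :
    ∀ᶠ x in 𝓝 ((0 : ℂ), s), x.1 ≠ 0 → ∀ j, multiplierRoot α i x j ≠ 0 := by
  have : ∀ᶠ x in 𝓝 ((0 : ℂ), s), ∀ j, α j + x.1 * (if j = i then x.2 else 0) ≠ 0 := by
    refine Filter.eventually_all.2 fun j => ContinuousAt.eventually_ne ?_ (by simpa using hα j)
    split_ifs <;> fun_prop
  filter_upwards [this] with x hx hx1 j h0
  refine hx j ?_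
  rw [multiplierRoot] at h0
  field_simp at h0
  rwa [mul_zero] at h0

theorem hasFloquetSolution_multiplierRoot_iff {q : Fin d → ℕ+} {V : (Fin d → ℤ) → ℂ}
    (hV : QuasiPeriodic q 1 V) {α : Fin d → ℂ} {i : Fin d} {x : ℂ × ℂ} (hx : x.1 ≠ 0)
    (hw : ∀ j, multiplierRoot α i x j ≠ 0) (lam : ℂ) :
    HasFloquetSolution q V (fun j => multiplierRoot α i x j ^ (q j : ℕ)) lam ↔
      ∃ p, p ≠ 0 ∧ (∑ j, α j • shift (Pi.single j 1)) p =
        x.1 • pencil q α i (fun g => V fun j => (g j).cast) lam x p := by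
  rw [hasFloquetSolution_pow_iff hV hw]
  refine exists_congr fun p => and_congr_right fun _ => ?_
  rw [funext_iff]
  refine forall_congr' fun g => ?_
  have hinv : ∀ j, x.1 * (α j + x.1 * (if j = i then x.2 else 0))⁻¹ = (multiplierRoot α i x j)⁻¹ := by
    intro j
    have : α j + x.1 * (if j = i then x.2 else 0) = x.1 * multiplierRoot α i x j := by
      rw [multiplierRoot]; field_simp
    rw [this, mul_inv, mul_inv_cancel_left₀ hx]
  have h1 : ∑ j, multiplierRoot α i x j * p (g + Pi.single j 1) =
      x.1⁻¹ * ∑ j, α j * p (g + Pi.single j 1) + x.2 * p (g + Pi.single i 1) := by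
    simp only [multiplierRoot, add_mul, Finset.sum_add_distrib, ite_mul, zero_mul, Finset.sum_ite_eq',
      Finset.mem_univ, if_true, Finset.mul_sum]
    congr 1
    exact Finset.sum_congr rfl fun j _ => by ring
  simp only [pencil, hinv, sum_apply, sub_apply,
    smul_apply, Finset.sum_apply, Pi.smul_apply, Pi.sub_apply, shift_apply,
    smul_eq_mul, ContinuousLinearMap.mul_apply', Pi.mul_apply, ContinuousLinearMap.id_apply,
    Finset.sum_add_distrib, h1, ← sub_eq_add_neg]
  constructor
  · intro h
    have := congrArg (x.1 * ·) h
    simp only [mul_add, mul_neg, mul_inv_cancel_left₀ hx] at this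
    linear_combination -this
  · intro h
    rw [h]
    field_simp
    ring

theorem IsGenericDirection.frequently_hasFloquetSolution {q : Fin d → ℕ+} {α : Fin d → ℂ}
    (hα : IsGenericDirection q α) (i : Fin d) {V : (Fin d → ℤ) → ℂ} (hV : QuasiPeriodic q 1 V)
    {s lam : ℂ} (hs : average (∀ j, ZMod (q j : ℕ)) (fun g => V fun j => (g j).cast) - lam = s) :
    ∃ᶠ x in 𝓝 ((0 : ℂ), s), x.1 ≠ 0 ∧ (∀ j, multiplierRoot α i x j ≠ 0) ∧
      HasFloquetSolution q V (fun j => multiplierRoot α i x j ^ (q j : ℕ)) lam := by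
  have := frequently_exists_ker_of_simple (∑ j, α j • shift (Pi.single j 1))
    (average (∀ j, ZMod (q j : ℕ))) 1 average_one
    (by simp [shift_one, ← Finset.sum_smul, hα.sum_eq_zero])
    (fun p => by simp [average_shift, ← Finset.sum_mul,
      hα.sum_eq_zero])
    (fun p => eq_zero_of_sum_shift_eq_zero _ _ hα.addChar_eq_zero) _ s
    (contDiffAt_pencil hα.ne_zero i (fun g => V fun j => (g j).cast) lam s) _ _
    (pencil_zero _ _ _ _ _) (by simp [shift_one, average_one])
    (by rw [average_mul_sub_smul_one, hs])
  refine (this.and_eventually (eventually_multiplierRoot_ne_zero hα.ne_zero i s)).mono ?_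
  rintro x ⟨⟨hx, h⟩, hw⟩
  exact ⟨hx, hw hx, (hasFloquetSolution_multiplierRoot_iff hV hx (hw hx) lam).2 h⟩

theorem IsGenericDirection.average_sub_eq {q : Fin d → ℕ+} {α : Fin d → ℂ}
    (hα : IsGenericDirection q α) {i : Fin d} {V : (Fin d → ℤ) → ℂ} (hV : QuasiPeriodic q 1 V)
    {s lam : ℂ} (h : ∃ᶠ x in 𝓝 ((0 : ℂ), s), x.1 ≠ 0 ∧
      HasFloquetSolution q V (fun j => multiplierRoot α i x j ^ (q j : ℕ)) lam) :
    average (∀ j, ZMod (q j : ℕ)) (fun g => V fun j => (g j).cast) - lam = s := by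
  rw [← average_mul_sub_smul_one]
  refine eq_of_frequently_exists_ker (∑ j, α j • shift (Pi.single j 1))
    (average (∀ j, ZMod (q j : ℕ))) 1 average_one
    (by simp [shift_one, ← Finset.sum_smul, hα.sum_eq_zero])
    (fun p => by simp [average_shift, ← Finset.sum_mul,
      hα.sum_eq_zero])
    (fun p => eq_zero_of_sum_shift_eq_zero _ _ hα.addChar_eq_zero) _ s
    (contDiffAt_pencil hα.ne_zero i (fun g => V fun j => (g j).cast) lam s).continuousAt _ _
    (pencil_zero _ _ _ _ _) (by simp [shift_one, average_one]) ?_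
  refine (h.and_eventually (eventually_multiplierRoot_ne_zero hα.ne_zero i s)).mono ?_
  rintro x ⟨⟨hx, h⟩, hw⟩
  exact ⟨hx, (hasFloquetSolution_multiplierRoot_iff hV hx (hw hx) lam).1 h⟩

end Pencil

section FermiIsospectral

open Topology

theorem IsPeriodicR.quasiPeriodic {d : ℕ} {q : Fin d → ℕ+} {V : (Fin d → ℤ) → ℝ}
    (hV : IsPeriodicR q V) : QuasiPeriodic q 1 (fun n => (V n : ℂ)) := by
  intro n j
  simp only [← update_add_eq_add_single, Pi.one_apply, one_mul]
  rw [hV n j]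

theorem FermiVariety_subset_iff {d : ℕ} {q : Fin d → ℕ+} {V Y : (Fin d → ℤ) → ℂ} {lam : ℂ} :
    FermiVariety q V lam ⊆ FermiVariety q Y lam ↔ ∀ z : Fin d → ℂ, (∀ j, z j ≠ 0) →
      HasFloquetSolution q V z lam → HasFloquetSolution q Y z lam := by
  simp only [Set.subset_def, mem_FermiVariety_iff]
  refine ⟨fun h z hz hV => ?_, fun h k => h _ fun j => Complex.exp_ne_zero _⟩
  have := h fun j => Complex.log (z j) / (2 * (Real.pi : ℂ) * Complex.I)
  simp only [mul_div_cancel₀ _ Complex.two_pi_I_ne_zero, Complex.exp_log (hz _)] at this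
  exact this hV

theorem HasFloquetSolution.add_const {d : ℕ} {q : Fin d → ℕ+} {V : (Fin d → ℤ) → ℂ}
    {z : Fin d → ℂ} {lam : ℂ} (c : ℂ) (h : HasFloquetSolution q V z lam) :
    HasFloquetSolution q (fun n => V n + c) z (lam + c) := by
  obtain ⟨u, hu0, hu, hqu⟩ := h
  exact ⟨u, hu0, fun n => by linear_combination hu n, hqu⟩

variable {d₁ d₂ : ℕ}

theorem HasFloquetSolution.transfer {q : Fin (d₁ + d₂) → ℕ+} {V₁ Y₁ : (Fin d₁ → ℤ) → ℂ}
    {V₂ Y₂ : (Fin d₂ → ℤ) → ℂ} {lam : ℂ} {α : Fin d₁ → ℂ} (i : Fin d₁)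
    (hα : IsGenericDirection (fun i => q (Fin.castAdd d₂ i)) α)
    (hV₁ : QuasiPeriodic (fun i => q (Fin.castAdd d₂ i)) 1 V₁)
    (hY₁ : QuasiPeriodic (fun i => q (Fin.castAdd d₂ i)) 1 Y₁)
    (hY₂ : QuasiPeriodic (fun i => q (Fin.natAdd d₁ i)) 1 Y₂)
    (hsub : ∀ z : Fin (d₁ + d₂) → ℂ, (∀ j, z j ≠ 0) →
      HasFloquetSolution q (fun n => V₁ (fun i => n (Fin.castAdd d₂ i))
        + V₂ (fun i => n (Fin.natAdd d₁ i))) z lam →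
      HasFloquetSolution q (fun n => Y₁ (fun i => n (Fin.castAdd d₂ i))
        + Y₂ (fun i => n (Fin.natAdd d₁ i))) z lam)
    {z : Fin d₂ → ℂ} (hz : ∀ j, z j ≠ 0) {nu : ℂ}
    (h : HasFloquetSolution (fun i => q (Fin.natAdd d₁ i)) V₂ z nu) :
    HasFloquetSolution (fun i => q (Fin.natAdd d₁ i)) Y₂ z
      (nu + (average (∀ j, ZMod (q (Fin.castAdd d₂ j) : ℕ)) (fun g => V₁ fun j => (g j).cast)
        - average (∀ j, ZMod (q (Fin.castAdd d₂ j) : ℕ)) (fun g => Y₁ fun j => (g j).cast))) := by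
  set s := average (∀ j, ZMod (q (Fin.castAdd d₂ j) : ℕ)) (fun g => V₁ fun j => (g j).cast)
    - (lam - nu) with hs
  have hfin : (spectrum ℂ (DVmat (fun i => q (Fin.natAdd d₁ i)) Y₂ z)).Finite :=
    Matrix.finite_spectrum _
  have hfreq : ∃ᶠ x in 𝓝 ((0 : ℂ), s),
      ∃ mu ∈ spectrum ℂ (DVmat (fun i => q (Fin.natAdd d₁ i)) Y₂ z),
      x.1 ≠ 0 ∧ HasFloquetSolution (fun i => q (Fin.castAdd d₂ i)) Y₁
        (fun j => multiplierRoot α i x j ^ (q (Fin.castAdd d₂ j) : ℕ)) (lam - mu) := by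
    refine (hα.frequently_hasFloquetSolution i hV₁ hs.symm).mono ?_
    rintro x ⟨hx, hw, h₁⟩
    set w : Fin d₁ → ℂ := fun j => multiplierRoot α i x j ^ (q (Fin.castAdd d₂ j) : ℕ)
    have hZ : ∀ j, Fin.append w z j ≠ 0 := by
      intro j
      refine Fin.addCases (fun i => ?_) (fun i => ?_) j
      · rw [Fin.append_left]
        exact pow_ne_zero _ (hw i)
      · rw [Fin.append_right]
        exact hz i
    obtain ⟨mu, hmu₁, hmu₂⟩ := (hsub (Fin.append w z) hZ (HasFloquetSolution.separable
      (nu := nu) (by simpa only [Fin.append_left] using h₁)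
      (by simpa only [Fin.append_right] using h))).exists_of_separable hY₂ hZ
    simp only [Fin.append_left, Fin.append_right] at hmu₁ hmu₂
    exact ⟨mu, (mem_spectrum_DVmat_iff hz hY₂ mu).2 hmu₂, hx, hmu₁⟩
  obtain ⟨mu, hmu, hx⟩ : ∃ mu ∈ spectrum ℂ (DVmat (fun i => q (Fin.natAdd d₁ i)) Y₂ z),
      ∃ᶠ x in 𝓝 ((0 : ℂ), s), x.1 ≠ 0 ∧ HasFloquetSolution (fun i => q (Fin.castAdd d₂ i)) Y₁
        (fun j => multiplierRoot α i x j ^ (q (Fin.castAdd d₂ j) : ℕ)) (lam - mu) := by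
    by_contra! hcon
    refine hfreq (((Filter.eventually_all_finite hfin).2 hcon).mono ?_)
    rintro x hx ⟨mu, hmu, h⟩
    exact hx mu hmu h.1 h.2
  have hmu' := hα.average_sub_eq hY₁ hx
  rw [mem_spectrum_DVmat_iff hz hY₂] at hmu
  convert hmu using 1
  rw [hs] at hmu'
  linear_combination -hmu'

end FermiIsospectral

/-- Let `d = d₁ + d₂` with `d₁ ≥ 2`, `d₂ ≥ 1`.  Suppose
`V = V₁ ⊕ V₂` and `Y = Y₁ ⊕ Y₂` are `(d₁, d₂)`-separable real `Γ`-periodic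
potentials on `ℤ^d` (with `V₁, Y₁` periodic in the first `d₁` variables and
`V₂, Y₂` periodic in the last `d₂` variables).  If `V` and `Y` are Fermi
isospectral, then there is a constant `c ∈ ℝ` such that `V₂ + c` and `Y₂` are
Floquet isospectral as periodic potentials on `ℤ^{d₂}`. -/
theorem statement14 (d₁ d₂ : ℕ) (hd₁ : 2 ≤ d₁) (hd₂ : 1 ≤ d₂)
    (q : Fin (d₁ + d₂) → ℕ+)
    (hq : ∀ i j, i ≠ j → Nat.Coprime (q i) (q j))
    (V₁ Y₁ : (Fin d₁ → ℤ) → ℝ) (V₂ Y₂ : (Fin d₂ → ℤ) → ℝ)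
    (hV₁ : IsPeriodicR (fun i => q (Fin.castAdd d₂ i)) V₁)
    (hY₁ : IsPeriodicR (fun i => q (Fin.castAdd d₂ i)) Y₁)
    (hV₂ : IsPeriodicR (fun i => q (Fin.natAdd d₁ i)) V₂)
    (hY₂ : IsPeriodicR (fun i => q (Fin.natAdd d₁ i)) Y₂)
    (lam0 : ℂ)
    (hiso :
      FermiVariety q (fun n =>
          (((V₁ (fun i => n (Fin.castAdd d₂ i)) + V₂ (fun i => n (Fin.natAdd d₁ i)) : ℝ)) : ℂ)) lam0
        = FermiVariety q (fun n =>
          (((Y₁ (fun i => n (Fin.castAdd d₂ i)) + Y₂ (fun i => n (Fin.natAdd d₁ i)) : ℝ)) : ℂ)) lam0) :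
    ∃ c : ℝ, FloquetIso (fun i => q (Fin.natAdd d₁ i)) (fun n => V₂ n + c) Y₂ := by
  obtain ⟨α, hα⟩ := exists_isGenericDirection hd₁ (fun i => q (Fin.castAdd d₂ i))
    fun i j hij => hq _ _ fun h => hij (Fin.castAdd_injective d₁ d₂ h)
  let i₀ : Fin d₁ := ⟨0, by omega⟩
  let avg : ((Fin d₁ → ℤ) → ℝ) → ℝ := fun V =>
    (Fintype.card (∀ j, ZMod (q (Fin.castAdd d₂ j) : ℕ)) : ℝ)⁻¹ *
      ∑ g : ∀ j, ZMod (q (Fin.castAdd d₂ j) : ℕ), V fun j => (g j).cast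
  have havg : ∀ V, average (∀ j, ZMod (q (Fin.castAdd d₂ j) : ℕ))
      (fun g => (V fun j => (g j).cast : ℂ)) = avg V := by
    intro V
    simp only [average_apply, avg]
    push_cast
    rfl
  simp only [Complex.ofReal_add] at hiso
  refine ⟨avg V₁ - avg Y₁, fun k => Set.ext fun mu => ?_⟩
  have hz : ∀ j, Complex.exp (2 * (Real.pi : ℂ) * Complex.I * (k j : ℂ)) ≠ 0 := fun j =>
    Complex.exp_ne_zero _
  have hV₂c : IsPeriodicR (fun i => q (Fin.natAdd d₁ i)) fun n => V₂ n + (avg V₁ - avg Y₁) :=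
    fun n j => congrArg (· + (avg V₁ - avg Y₁)) (hV₂ n j)
  rw [mem_spectrum_DVmat_iff hz hV₂c.quasiPeriodic, mem_spectrum_DVmat_iff hz hY₂.quasiPeriodic]
  simp only [Complex.ofReal_add, Complex.ofReal_sub]
  constructor
  · intro h
    have h1 := h.add_const (-(avg V₁ - avg Y₁ : ℂ))
    simp only [add_neg_cancel_right] at h1
    have h2 := h1.transfer i₀ hα hV₁.quasiPeriodic hY₁.quasiPeriodic hY₂.quasiPeriodic
      (FermiVariety_subset_iff.1 hiso.subset) hz
    rwa [havg, havg, neg_add_cancel_right] at h2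
  · intro h
    have h2 := h.transfer i₀ hα hY₁.quasiPeriodic hV₁.quasiPeriodic hV₂.quasiPeriodic
      (FermiVariety_subset_iff.1 hiso.symm.subset) hz
    rw [havg, havg] at h2
    have h3 := h2.add_const (avg V₁ - avg Y₁ : ℂ)
    rwa [add_assoc, sub_add_sub_cancel, sub_self, add_zero] at h3

end
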